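/- (Complex Gap Lemma) Let K and L be dynamical Cantor sets that are limit sets of IFSs of univalent contractions defined on the same square S, each with finite distortion. Suppose K and L are well balanced, i.e., max(Λ_K, Λ_L) < 1/20, every disk of diameter > δ(P)/(20 D_L²) inside a piece P of K contains a son of P, and every disk of diameter > δ(P)/(20 D_K²) inside a piece P of L contains a son of P. If t(K)·t(L) ≥ 1, then K ∩ L ≠ ∅. -/

import Mathlib

open Metric

/-- The open axis-parallel square centered at 0 with side length `s`. -/
def square0 (s : ℝ) : Set ℂ := {z : ℂ | |z.re| < s/2 ∧ |z.im| < s/2}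

/-- For a word `I = (i₁,…,i_k)`, the composition `f_I = f_{i_k} ∘ ⋯ ∘ f_{i_1}`. -/
def wordMap {p : ℕ} (f : Fin p → ℂ → ℂ) (I : List (Fin p)) (z : ℂ) : ℂ :=
  I.foldl (fun w i => f i w) z

/-- The inscribed-disk diameter of `P` centered at `c`: the diameter of the largest open
disk of center `c` contained in `P`. -/
noncomputable def inscDiam (P : Set ℂ) (c : ℂ) : ℝ :=
  sSup {d : ℝ | 0 ≤ d ∧ ball c (d/2) ⊆ P}

/-- The escribed-disk diameter of `P` centered at `c`: the diameter of the smallest disk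
of center `c` containing `P`. -/
noncomputable def escDiam (P : Set ℂ) (c : ℂ) : ℝ :=
  sInf {d : ℝ | 0 ≤ d ∧ P ⊆ ball c (d/2)}

/-- The square of diameter 1 centered at 0. -/
noncomputable def S₁ : Set ℂ := square0 (1/Real.sqrt 2)

/-- The successive approximations `K_n` of the limit set of the IFS `{f_i}` on `S₁`. -/
noncomputable def ifsKn {p : ℕ} (f : Fin p → ℂ → ℂ) : ℕ → Set ℂ
  | 0 => S₁
  | n + 1 => ⋃ i : Fin p, f i '' ifsKn f n

/-- The limit set of the IFS. -/
noncomputable def limitSet {p : ℕ} (f : Fin p → ℂ → ℂ) : Set ℂ := ⋂ n : ℕ, ifsKn f n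

/-- The distorted maximal reduction ratio `λ_K = (1/D²)·min_i δ(f_i(S))/δ(S)`. -/
noncomputable def lamK {p : ℕ} (f : Fin p → ℂ → ℂ) (D : ℝ) : ℝ :=
  (1/D^2) * sInf {x : ℝ | ∃ i : Fin p, x = inscDiam (f i '' S₁) (f i 0) / inscDiam S₁ 0}

/-- The distorted minimal reduction ratio `Λ_K = D²·max_i Δ(f_i(S))/δ(S)`. -/
noncomputable def LamK {p : ℕ} (f : Fin p → ℂ → ℂ) (D : ℝ) : ℝ :=
  D^2 * sSup {x : ℝ | ∃ i : Fin p, x = escDiam (f i '' S₁) (f i 0) / inscDiam S₁ 0}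

/-- `ρ(S)`: the diameter of the largest open disk contained in `S₁` and disjoint from `K`. -/
noncomputable def gapDiam (K : Set ℂ) : ℝ :=
  sSup {d : ℝ | ∃ c : ℂ, ball c (d/2) ⊆ S₁ ∧ Disjoint (ball c (d/2)) K}

/-- The (distorted) gap `σ_K = D²·ρ(S)/δ(S)`. -/
noncomputable def sigmaK {p : ℕ} (f : Fin p → ℂ → ℂ) (D : ℝ) : ℝ :=
  D^2 * (gapDiam (limitSet f) / inscDiam S₁ 0)

/-- The thickness `t(K) = λ_K/(D²·√σ_K)`. -/
noncomputable def thickK {p : ℕ} (f : Fin p → ℂ → ℂ) (D : ℝ) : ℝ :=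
  lamK f D / (D^2 * Real.sqrt (sigmaK f D))

section ConformalGeometry

/-- Pulling back a ball inside the univalent image of a convex open set. -/
theorem ball_subset_of_ball_subset_image {S : Set ℂ} (hS : IsOpen S) (hc : Convex ℝ S)
    {F : ℂ → ℂ} {M r t : ℝ} {z : ℂ} (hF : ∀ w ∈ closure S, DifferentiableAt ℂ F w)
    (hM : ∀ w ∈ closure S, ‖deriv F w‖ ≤ M) (hM0 : 0 < M) (hinj : Set.InjOn F (closure S))
    (hz : z ∈ S) (hball : ball (F z) r ⊆ F '' S) (ht : M * t ≤ r) : ball z t ⊆ S := by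
  rcases le_or_gt t 0 with h0 | h0
  · simp [ball_eq_empty.2 h0]
  refine (convex_ball z t).isPreconnected.subset_of_closure_inter_subset hS
    ⟨z, mem_ball_self h0, hz⟩ ?_
  rintro w ⟨hw, hwt⟩
  have h1 := hc.closure.norm_image_sub_le_of_norm_deriv_le hF hM (subset_closure hz) hw
  have h2 : F w ∈ ball (F z) r := by
    rw [mem_ball_iff_norm] at hwt ⊢
    exact h1.trans_lt ((mul_lt_mul_of_pos_left hwt hM0).trans_le ht)
  obtain ⟨y, hy, hyw⟩ := hball h2
  rwa [← hinj (subset_closure hy) hw hyw]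

/-- A holomorphic map whose derivative is at least `m` in modulus on a ball of radius `r`
covers a ball of radius `m * r`. -/
theorem ball_subset_image_ball {F : ℂ → ℂ} {m r : ℝ} {z : ℂ} (hm : 0 < m)
    (hF : ∀ w ∈ ball z r, DifferentiableAt ℂ F w) (hd : ∀ w ∈ ball z r, m ≤ ‖deriv F w‖) :
    ball (F z) (m * r) ⊆ F '' ball z r := by
  intro w hw
  rw [mem_ball_iff_norm'] at hw
  have hr : 0 < r := by
    by_contra! h
    nlinarith [norm_nonneg (F z - w)]
  obtain ⟨m', h1, h2⟩ := exists_between ((div_lt_iff₀ hr).2 hw)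
  have hm' : 0 < m' := lt_of_le_of_lt (by positivity) h1
  have h3 : ‖F z - w‖ / m' < r := by
    rw [div_lt_iff₀ hm']; rw [div_lt_iff₀ hr] at h1; linarith
  obtain ⟨r', h4, h5⟩ := exists_between h3
  have hsub : closedBall z r' ⊆ ball z r := closedBall_subset_ball h5
  have hr' : 0 ≤ r' := le_trans (by positivity) h4.le
  obtain ⟨x, hx, hmin⟩ := (isCompact_closedBall z r').exists_isMinOn
    (f := fun y => ‖F y - w‖ + m' * ‖y - z‖) ⟨z, mem_closedBall_self hr'⟩ (by
      have : ContinuousOn F (closedBall z r') := fun y hy =>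
        (hF y (hsub hy)).continuousAt.continuousWithinAt
      fun_prop)
  have hxz : ‖F x - w‖ + m' * ‖x - z‖ ≤ ‖F z - w‖ := by
    simpa using hmin (mem_closedBall_self hr')
  have hxr : ‖x - z‖ < r' := by
    rw [div_lt_iff₀ hm'] at h4
    by_contra! h
    nlinarith [norm_nonneg (F x - w)]
  refine ⟨x, hsub hx, ?_⟩
  by_contra hne
  have hA : 0 < ‖F x - w‖ := norm_pos_iff.2 (sub_ne_zero.2 hne)
  have hdx : m ≤ ‖deriv F x‖ := hd x (hsub hx)
  have hd0 : 0 < ‖deriv F x‖ := hm.trans_le hdx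
  have hd0' : deriv F x ≠ 0 := norm_pos_iff.1 hd0
  have hlo := (hF x (hsub hx)).hasDerivAt.isLittleO.def (c := (m - m') / 2) (by linarith)
  set ζ : ℝ → ℂ := fun t => x - t * ((F x - w) / deriv F x) with hζ
  have hζt : Filter.Tendsto ζ (nhdsWithin 0 (Set.Ioi 0)) (nhds x) := by
    have : Continuous ζ := by fun_prop
    have h := (this.tendsto 0).mono_left (nhdsWithin_le_nhds (s := Set.Ioi 0))
    simpa [hζ] using h
  have hin : ball z r' ∈ nhds x := isOpen_ball.mem_nhds (by rwa [mem_ball_iff_norm])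
  have hI : Set.Ioo (0 : ℝ) 1 ∈ nhdsWithin (0 : ℝ) (Set.Ioi 0) := Ioo_mem_nhdsGT one_pos
  obtain ⟨t, ⟨⟨ht1, ht2⟩, ht3⟩, ht4⟩ :=
    ((Filter.Eventually.and hI (hζt.eventually hlo)).and (hζt.eventually hin)).exists
  have hmt : ‖F x - w‖ + m' * ‖x - z‖ ≤ ‖F (ζ t) - w‖ + m' * ‖ζ t - z‖ :=
    hmin (ball_subset_closedBall ht4)
  have hnorm : ‖ζ t - x‖ = t * (‖F x - w‖ / ‖deriv F x‖) := by
    simp [hζ, abs_of_pos ht1]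
  have e1 : F (ζ t) - w =
      (F (ζ t) - F x - (ζ t - x) • deriv F x) + ((1 - t : ℝ) : ℂ) * (F x - w) := by
    simp only [hζ, smul_eq_mul]
    push_cast
    field_simp
    ring
  have e2 : ‖F (ζ t) - w‖ ≤ (m - m') / 2 * ‖ζ t - x‖ + (1 - t) * ‖F x - w‖ := by
    rw [e1]
    refine (norm_add_le _ _).trans (add_le_add ht3 ?_)
    rw [norm_mul, Complex.norm_real, Real.norm_of_nonneg (by linarith)]
  have e3 : ‖ζ t - z‖ ≤ ‖ζ t - x‖ + ‖x - z‖ := by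
    simpa using norm_add_le (ζ t - x) (x - z)
  have e4 : t * ‖F x - w‖ ≤ ((m + m') / 2) * ‖ζ t - x‖ := by
    nlinarith
  have e5 : t * ‖F x - w‖ = ‖ζ t - x‖ * ‖deriv F x‖ := by
    rw [hnorm]; field_simp
  have e6 : 0 < ‖ζ t - x‖ := by rw [hnorm]; positivity
  nlinarith

end ConformalGeometry

section Square

theorem S₁_eq : S₁ = {z : ℂ | |z.re| < 1 / √2 / 2 ∧ |z.im| < 1 / √2 / 2} := rfl

theorem isOpen_S₁ : IsOpen S₁ := by
  rw [S₁_eq]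
  exact (isOpen_lt (by fun_prop) (by fun_prop)).and (isOpen_lt (by fun_prop) (by fun_prop))

theorem convex_S₁ : Convex ℝ S₁ := by
  have h : S₁ = Complex.reLm ⁻¹' (ball 0 (1 / √2 / 2)) ∩
      Complex.imLm ⁻¹' (ball 0 (1 / √2 / 2)) := by
    ext z; simp [S₁_eq]
  rw [h]
  exact ((convex_ball _ _).linear_preimage _).inter ((convex_ball _ _).linear_preimage _)

/-- A ball contained in a vertical strip has at most half its width as radius. -/
theorem radius_le_of_ball_subset_strip {c : ℂ} {r b : ℝ} (hb : 0 ≤ b)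
    (h : ball c r ⊆ {z : ℂ | |z.re| < b}) : r ≤ b := by
  refine le_of_forall_lt fun t ht => ?_
  rcases lt_or_ge t 0 with h0 | h0
  · linarith
  have h1 : c + t ∈ ball c r := by simpa [abs_of_nonneg h0] using ht
  have h2 : c - t ∈ ball c r := by simpa [abs_of_nonneg h0] using ht
  have h3 : |(c + t).re| < b := h h1
  have h4 : |(c - t).re| < b := h h2
  rw [abs_lt] at h3 h4
  simp at h3 h4
  linarith

theorem bddAbove_inscDiam {P : Set ℂ} {c : ℂ} {b : ℝ} (hb : 0 ≤ b)
    (h : P ⊆ {z : ℂ | |z.re| < b}) : BddAbove {d : ℝ | 0 ≤ d ∧ ball c (d/2) ⊆ P} :=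
  ⟨2 * b, fun d hd => by
    have := radius_le_of_ball_subset_strip hb (hd.2.trans h)
    linarith⟩

theorem inscDiam_nonneg (P : Set ℂ) (c : ℂ) : 0 ≤ inscDiam P c :=
  Real.sSup_nonneg fun _ hd => hd.1

theorem ball_inscDiam_subset (P : Set ℂ) (c : ℂ) : ball c (inscDiam P c / 2) ⊆ P := by
  intro z hz
  rw [mem_ball] at hz
  have h : 2 * dist z c < inscDiam P c := by linarith
  have hne : {d : ℝ | 0 ≤ d ∧ ball c (d/2) ⊆ P}.Nonempty := ⟨0, le_rfl, by simp⟩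
  obtain ⟨d, hd, hzd⟩ := exists_lt_of_lt_csSup hne h
  exact hd.2 (by rw [mem_ball]; linarith)

theorem S₁_subset_strip : S₁ ⊆ {z : ℂ | |z.re| < 1 / √2 / 2} := fun _ hz => hz.1

theorem le_inscDiam {P : Set ℂ} (hP : P ⊆ S₁) {c : ℂ} {r : ℝ} (hr : 0 ≤ r) (h : ball c r ⊆ P) :
    2 * r ≤ inscDiam P c :=
  le_csSup (bddAbove_inscDiam (by positivity) (hP.trans S₁_subset_strip))
    ⟨by positivity, by simpa using h⟩

theorem inscDiam_S₁ : inscDiam S₁ 0 = 1 / √2 := by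
  apply le_antisymm
  · have := radius_le_of_ball_subset_strip (by positivity)
      ((ball_inscDiam_subset S₁ 0).trans S₁_subset_strip)
    linarith
  · have h : ball (0 : ℂ) (1 / √2 / 2) ⊆ S₁ := fun z hz => by
      rw [mem_ball_zero_iff] at hz
      exact ⟨(Complex.abs_re_le_norm z).trans_lt hz, (Complex.abs_im_le_norm z).trans_lt hz⟩
    have := le_inscDiam subset_rfl (by positivity) h
    linarith

theorem inscDiam_S₁_pos : 0 < inscDiam S₁ 0 := by
  rw [inscDiam_S₁]; positivity

theorem two_mul_radius_le {c : ℂ} {r : ℝ} (h : ball c r ⊆ S₁) : 2 * r ≤ inscDiam S₁ 0 := by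
  have := radius_le_of_ball_subset_strip (by positivity) (h.trans S₁_subset_strip)
  rw [inscDiam_S₁]; linarith

theorem norm_lt_of_mem_S₁ {z : ℂ} (hz : z ∈ S₁) : ‖z‖ < inscDiam S₁ 0 := by
  have := Complex.norm_le_abs_re_add_abs_im z
  rw [inscDiam_S₁]
  linarith [hz.1, hz.2]

theorem zero_mem_S₁ : (0 : ℂ) ∈ S₁ :=
  ball_inscDiam_subset S₁ 0 (mem_ball_self (half_pos inscDiam_S₁_pos))

theorem isCompact_closure_S₁ : IsCompact (closure S₁) :=
  (isBounded_ball.subset fun _ hz =>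
    mem_ball_zero_iff.2 (norm_lt_of_mem_S₁ hz)).isCompact_closure

/-- Near every point of the square there is a ball of comparable size in the square. -/
theorem exists_ball_subset_S₁ {z : ℂ} (hz : z ∈ S₁) {t : ℝ} (ht : 0 ≤ t)
    (hts : t ≤ inscDiam S₁ 0) : ∃ c ∈ S₁, ball c (t / 3) ⊆ S₁ ∧ ball c (t / 3) ⊆ ball z t := by
  have hs := inscDiam_S₁_pos
  have hzn := norm_lt_of_mem_S₁ hz
  set s := inscDiam S₁ 0 with hsdef
  set e := 2 / 3 * t / s with he
  have he0 : 0 ≤ e := by positivity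
  have he1 : e ≤ 1 := by rw [he, div_le_one hs]; linarith
  have hes : e * s = 2 / 3 * t := by rw [he]; field_simp
  have hcomb : ∀ w ∈ S₁, ((1 - e : ℝ) : ℂ) * z + (e : ℂ) * w ∈ S₁ := fun w hw => by
    simpa using convex_S₁ hz hw (a := 1 - e) (b := e) (by linarith) he0 (by ring)
  refine ⟨((1 - e : ℝ) : ℂ) * z, by simpa using hcomb 0 zero_mem_S₁, fun w hw => ?_,
    ball_subset_ball' ?_⟩
  · rw [mem_ball_iff_norm] at hw
    have hep : 0 < e := by
      have : 0 < t := by linarith [norm_nonneg (w - ((1 - e : ℝ) : ℂ) * z)]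
      positivity
    have hec : (e : ℂ) ≠ 0 := by exact_mod_cast hep.ne'
    have h := hcomb ((w - ((1 - e : ℝ) : ℂ) * z) / e) (ball_inscDiam_subset S₁ 0 (by
      rw [mem_ball_zero_iff, norm_div, Complex.norm_real, Real.norm_of_nonneg he0,
        div_lt_iff₀ hep]
      linarith))
    rw [mul_div_cancel₀ _ hec] at h
    simpa using h
  · have : dist (((1 - e : ℝ) : ℂ) * z) z = e * ‖z‖ := by
      rw [dist_eq_norm, ← Real.norm_of_nonneg he0, ← Complex.norm_real, ← norm_mul, ← norm_neg]
      congr 1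
      push_cast
      rw [Complex.norm_real, Real.norm_of_nonneg he0]
      ring
    rw [this]
    nlinarith

end Square

section IteratedFunctionSystem

/-- An iterated function system of univalent contractions of the square, with distortion
at most `D`. -/
structure IsUnivalentIFS {p : ℕ} (f : Fin p → ℂ → ℂ) (D : ℝ) : Prop where
  pos : 0 < p
  differentiableAt : ∀ i, ∀ z ∈ closure S₁, DifferentiableAt ℂ (f i) z
  injOn : ∀ i, Set.InjOn (f i) (closure S₁)
  closure_image_subset : ∀ i, closure (f i '' S₁) ⊆ S₁
  lipschitz : ∀ i, ∃ c : NNReal, c < 1 ∧ LipschitzOnWith c (f i) S₁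
  one_le : 1 ≤ D
  distortion : ∀ (I : List (Fin p)), ∀ z ∈ closure S₁, ∀ z' ∈ closure S₁,
    ‖deriv (wordMap f I) z‖ ≤ D * ‖deriv (wordMap f I) z'‖

/-- The supremum over the closed square of the modulus of the derivative of `f_I`. -/
noncomputable def maxDeriv {p : ℕ} (f : Fin p → ℂ → ℂ) (I : List (Fin p)) : ℝ :=
  sSup ((fun z => ‖deriv (wordMap f I) z‖) '' closure S₁)

/-- The inscribed-disk diameter of the piece `f_I(S₁)`. -/
noncomputable def pieceDiam {p : ℕ} (f : Fin p → ℂ → ℂ) (I : List (Fin p)) : ℝ :=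
  inscDiam (wordMap f I '' S₁) (wordMap f I 0)

theorem wordMap_cons {p : ℕ} (f : Fin p → ℂ → ℂ) (i : Fin p) (I : List (Fin p)) :
    wordMap f (i :: I) = wordMap f I ∘ f i := rfl

theorem wordMap_nil {p : ℕ} (f : Fin p → ℂ → ℂ) : wordMap f [] = id := rfl

theorem pieceDiam_nil {p : ℕ} (f : Fin p → ℂ → ℂ) : pieceDiam f [] = inscDiam S₁ 0 := by
  simp [pieceDiam, wordMap_nil]

theorem zero_mem_closure_S₁ : (0 : ℂ) ∈ closure S₁ := subset_closure zero_mem_S₁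

theorem maxDeriv_nonneg {p : ℕ} (f : Fin p → ℂ → ℂ) (I : List (Fin p)) : 0 ≤ maxDeriv f I :=
  Real.sSup_nonneg (by rintro _ ⟨z, -, rfl⟩; exact norm_nonneg _)

theorem maxDeriv_nil {p : ℕ} (f : Fin p → ℂ → ℂ) : maxDeriv f [] = 1 := by
  have : (closure S₁).Nonempty := ⟨0, zero_mem_closure_S₁⟩
  simp [maxDeriv, wordMap_nil, this]

theorem limitSet_subset_S₁ {p : ℕ} (f : Fin p → ℂ → ℂ) : limitSet f ⊆ S₁ :=
  Set.iInter_subset (ifsKn f) 0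

theorem lamK_nonneg {p : ℕ} (f : Fin p → ℂ → ℂ) (D : ℝ) : 0 ≤ lamK f D := by
  refine mul_nonneg (by positivity) (Real.sInf_nonneg ?_)
  rintro _ ⟨j, rfl⟩
  exact div_nonneg (inscDiam_nonneg _ _) inscDiam_S₁_pos.le

namespace IsUnivalentIFS

variable {p : ℕ} {f : Fin p → ℂ → ℂ} {D : ℝ}

theorem D_pos (h : IsUnivalentIFS f D) : 0 < D := one_pos.trans_le h.one_le

theorem continuousOn (h : IsUnivalentIFS f D) (i : Fin p) : ContinuousOn (f i) (closure S₁) :=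
  fun z hz => (h.differentiableAt i z hz).continuousAt.continuousWithinAt

theorem mapsTo_closure (h : IsUnivalentIFS f D) (i : Fin p) :
    Set.MapsTo (f i) (closure S₁) S₁ := fun _ hz =>
  h.closure_image_subset i ((h.continuousOn i).image_closure ⟨_, hz, rfl⟩)

theorem mapsTo (h : IsUnivalentIFS f D) (i : Fin p) : Set.MapsTo (f i) S₁ S₁ :=
  (h.mapsTo_closure i).mono_left subset_closure

theorem ifsKn_subset_S₁ (h : IsUnivalentIFS f D) (n : ℕ) : ifsKn f n ⊆ S₁ := by
  induction n with
  | zero => exact subset_rfl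
  | succ n ih =>
    exact Set.iUnion_subset fun i => (Set.image_mono ih).trans (h.mapsTo i).image_subset

theorem antitone_ifsKn (h : IsUnivalentIFS f D) : Antitone (ifsKn f) := by
  refine antitone_nat_of_succ_le fun n => ?_
  induction n with
  | zero => exact h.ifsKn_subset_S₁ 1
  | succ n ih => exact Set.iUnion_mono fun i => Set.image_mono ih

theorem closure_ifsKn_succ_subset (h : IsUnivalentIFS f D) (n : ℕ) :
    closure (ifsKn f (n + 1)) ⊆ ifsKn f n := by
  induction n with
  | zero =>
    simp only [ifsKn]
    rw [closure_iUnion_of_finite]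
    exact Set.iUnion_subset h.closure_image_subset
  | succ n ih =>
    rw [ifsKn, closure_iUnion_of_finite, ifsKn]
    refine Set.iUnion_mono fun i => ?_
    have hsub : closure (ifsKn f (n + 1)) ⊆ closure S₁ :=
      closure_mono (h.ifsKn_subset_S₁ _)
    have hcpt : IsCompact (closure (ifsKn f (n + 1))) :=
      isCompact_closure_S₁.of_isClosed_subset isClosed_closure hsub
    exact (closure_minimal (Set.image_mono subset_closure)
      (hcpt.image_of_continuousOn ((h.continuousOn i).mono hsub)).isClosed).trans
      (Set.image_mono ih)

theorem limitSet_eq_iInter_closure (h : IsUnivalentIFS f D) :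
    limitSet f = ⋂ n, closure (ifsKn f n) := by
  apply subset_antisymm
  · exact Set.iInter_mono fun n => subset_closure
  · exact Set.subset_iInter fun n => (Set.iInter_subset _ (n + 1)).trans
      (h.closure_ifsKn_succ_subset n)

theorem isCompact_limitSet (h : IsUnivalentIFS f D) : IsCompact (limitSet f) := by
  refine isCompact_closure_S₁.of_isClosed_subset ?_ ((limitSet_subset_S₁ f).trans subset_closure)
  rw [h.limitSet_eq_iInter_closure]
  exact isClosed_iInter fun n => isClosed_closure

theorem nonempty_ifsKn (h : IsUnivalentIFS f D) (n : ℕ) : (ifsKn f n).Nonempty := by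
  induction n with
  | zero => exact ⟨0, zero_mem_S₁⟩
  | succ n ih => exact Set.nonempty_iUnion.2 ⟨⟨0, h.pos⟩, ih.image _⟩

theorem nonempty_limitSet (h : IsUnivalentIFS f D) : (limitSet f).Nonempty := by
  rw [h.limitSet_eq_iInter_closure]
  exact IsCompact.nonempty_iInter_of_sequence_nonempty_isCompact_isClosed _
    (fun n => closure_mono (h.antitone_ifsKn n.le_succ))
    (fun n => (h.nonempty_ifsKn n).closure) isCompact_closure_S₁ fun n => isClosed_closure

theorem mapsTo_limitSet (h : IsUnivalentIFS f D) (i : Fin p) :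
    Set.MapsTo (f i) (limitSet f) (limitSet f) := by
  intro z hz
  refine Set.mem_iInter.2 fun n => h.antitone_ifsKn n.le_succ ?_
  exact Set.mem_iUnion.2 ⟨i, z, Set.mem_iInter.1 hz n, rfl⟩

theorem exists_preimage (h : IsUnivalentIFS f D) {z : ℂ} (hz : z ∈ limitSet f) :
    ∃ i, ∃ y ∈ limitSet f, f i y = z := by
  have hn : ∀ n, ∃ i, z ∈ f i '' ifsKn f n := fun n =>
    Set.mem_iUnion.1 (Set.mem_iInter.1 hz (n + 1))
  choose i hi using hn
  obtain ⟨j, hj⟩ := Finite.exists_infinite_fiber i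
  have hinf : (i ⁻¹' {j}).Infinite := Set.infinite_coe_iff.1 hj
  have hmem : ∀ n, z ∈ f j '' ifsKn f n := fun n => by
    obtain ⟨m, hm, hnm⟩ := hinf.exists_gt n
    have := hi m
    rw [show i m = j from hm] at this
    exact Set.image_mono (h.antitone_ifsKn hnm.le) this
  obtain ⟨y, hy, hyz⟩ := hmem 0
  refine ⟨j, y, Set.mem_iInter.2 fun n => ?_, hyz⟩
  obtain ⟨y', hy', hyz'⟩ := hmem n
  rwa [h.injOn j (subset_closure (h.ifsKn_subset_S₁ 0 hy))
    (subset_closure (h.ifsKn_subset_S₁ n hy')) (hyz.trans hyz'.symm)]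

theorem wordMap_mapsTo (h : IsUnivalentIFS f D) (I : List (Fin p)) :
    Set.MapsTo (wordMap f I) S₁ S₁ := by
  induction I with
  | nil => exact Set.mapsTo_id _
  | cons i I ih => exact ih.comp (h.mapsTo i)

theorem wordMap_mapsTo_limitSet (h : IsUnivalentIFS f D) (I : List (Fin p)) :
    Set.MapsTo (wordMap f I) (limitSet f) (limitSet f) := by
  induction I with
  | nil => exact Set.mapsTo_id _
  | cons i I ih => exact ih.comp (h.mapsTo_limitSet i)

theorem wordMap_image_subset (h : IsUnivalentIFS f D) (I : List (Fin p)) :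
    wordMap f I '' S₁ ⊆ S₁ := (h.wordMap_mapsTo I).image_subset

theorem wordMap_differentiableAt (h : IsUnivalentIFS f D) (I : List (Fin p)) :
    ∀ z ∈ closure S₁, DifferentiableAt ℂ (wordMap f I) z := by
  induction I with
  | nil => exact fun z _ => differentiableAt_id
  | cons i I ih =>
    exact fun z hz => (ih _ (subset_closure (h.mapsTo_closure i hz))).comp z
      (h.differentiableAt i z hz)

theorem wordMap_injOn (h : IsUnivalentIFS f D) (I : List (Fin p)) :
    Set.InjOn (wordMap f I) (closure S₁) := by
  induction I with
  | nil => exact Set.injOn_id _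
  | cons i I ih => exact ih.comp (h.injOn i) ((h.mapsTo_closure i).mono_right subset_closure)

theorem norm_deriv_le_maxDeriv (h : IsUnivalentIFS f D) (I : List (Fin p)) {z : ℂ}
    (hz : z ∈ closure S₁) : ‖deriv (wordMap f I) z‖ ≤ maxDeriv f I := by
  refine le_csSup ⟨D * ‖deriv (wordMap f I) 0‖, ?_⟩ ⟨z, hz, rfl⟩
  rintro _ ⟨w, hw, rfl⟩
  exact h.distortion I w hw 0 zero_mem_closure_S₁

theorem maxDeriv_le_mul_norm_deriv (h : IsUnivalentIFS f D) (I : List (Fin p)) {z : ℂ}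
    (hz : z ∈ closure S₁) : maxDeriv f I ≤ D * ‖deriv (wordMap f I) z‖ := by
  refine csSup_le (Set.Nonempty.image _ ⟨z, hz⟩) ?_
  rintro _ ⟨w, hw, rfl⟩
  exact h.distortion I w hw z hz

theorem maxDeriv_mul_le (h : IsUnivalentIFS f D) (i : Fin p) (I : List (Fin p)) :
    maxDeriv f I * maxDeriv f [i] ≤ D * maxDeriv f (i :: I) := by
  rcases (maxDeriv_nonneg f I).eq_or_lt with h0 | h0
  · rw [← h0, zero_mul]
    exact mul_nonneg h.D_pos.le (maxDeriv_nonneg _ _)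
  rw [← le_div_iff₀' h0]
  refine csSup_le (Set.Nonempty.image _ ⟨0, zero_mem_closure_S₁⟩) ?_
  rintro _ ⟨w, hw, rfl⟩
  have hw' : f i w ∈ closure S₁ := subset_closure (h.mapsTo_closure i hw)
  have hd : deriv (wordMap f (i :: I)) w = deriv (wordMap f I) (f i w) * deriv (f i) w := by
    rw [wordMap_cons]
    exact deriv_comp w (h.wordMap_differentiableAt I _ hw') (h.differentiableAt i w hw)
  have h1 := h.norm_deriv_le_maxDeriv (i :: I) hw
  rw [hd, norm_mul] at h1
  have h2 := h.maxDeriv_le_mul_norm_deriv I hw'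
  have h3 : deriv (wordMap f [i]) w = deriv (f i) w := rfl
  simp only [h3]
  rw [le_div_iff₀' h0]
  calc maxDeriv f I * ‖deriv (f i) w‖
      ≤ D * ‖deriv (wordMap f I) (f i w)‖ * ‖deriv (f i) w‖ := by gcongr
    _ = D * (‖deriv (wordMap f I) (f i w)‖ * ‖deriv (f i) w‖) := by ring
    _ ≤ _ := mul_le_mul_of_nonneg_left h1 h.D_pos.le

theorem ball_subset_S₁ (h : IsUnivalentIFS f D) (I : List (Fin p)) {z : ℂ} (hz : z ∈ S₁)
    {M r t : ℝ} (hM0 : 0 < M) (hM : maxDeriv f I ≤ M)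
    (hball : ball (wordMap f I z) r ⊆ wordMap f I '' S₁) (ht : M * t ≤ r) : ball z t ⊆ S₁ :=
  ball_subset_of_ball_subset_image isOpen_S₁ convex_S₁ (h.wordMap_differentiableAt I)
    (fun _ hw => (h.norm_deriv_le_maxDeriv I hw).trans hM) hM0 (h.wordMap_injOn I) hz hball ht

theorem diam_le_of_ball_subset (h : IsUnivalentIFS f D) (I : List (Fin p)) {z : ℂ} (hz : z ∈ S₁)
    {d : ℝ} (hball : ball (wordMap f I z) (d / 2) ⊆ wordMap f I '' S₁) :
    d ≤ maxDeriv f I * inscDiam S₁ 0 := by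
  have hs := inscDiam_S₁_pos
  by_contra! hlt
  rw [← lt_div_iff₀ hs] at hlt
  obtain ⟨M, hM1, hM2⟩ := exists_between hlt
  have hM0 : 0 < M := (maxDeriv_nonneg f I).trans_lt hM1
  have h1 := two_mul_radius_le (h.ball_subset_S₁ I hz hM0 hM1.le hball (t := d / (2 * M))
    (le_of_eq (by field_simp)))
  rw [lt_div_iff₀ hs] at hM2
  have h2 : 2 * (d / (2 * M)) = d / M := by field_simp
  rw [h2, div_le_iff₀ hM0] at h1
  linarith

theorem pieceDiam_le (h : IsUnivalentIFS f D) (I : List (Fin p)) :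
    pieceDiam f I ≤ maxDeriv f I * inscDiam S₁ 0 :=
  h.diam_le_of_ball_subset I zero_mem_S₁ (ball_inscDiam_subset _ _)

theorem ball_subset_wordMap_image (h : IsUnivalentIFS f D) (I : List (Fin p)) {z : ℂ} {r : ℝ}
    (hpos : 0 < maxDeriv f I) (hball : ball z r ⊆ S₁) :
    ball (wordMap f I z) (maxDeriv f I / D * r) ⊆ wordMap f I '' ball z r :=
  ball_subset_image_ball (div_pos hpos h.D_pos)
    (fun w hw => h.wordMap_differentiableAt I w (subset_closure (hball hw)))
    fun w hw => by
      rw [div_le_iff₀' h.D_pos]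
      exact h.maxDeriv_le_mul_norm_deriv I (subset_closure (hball hw))

theorem maxDeriv_mul_pieceDiam_le (h : IsUnivalentIFS f D) (i : Fin p) (I : List (Fin p))
    (hpos : 0 < maxDeriv f I) : maxDeriv f I / D * pieceDiam f [i] ≤ pieceDiam f (i :: I) := by
  have h1 : ball (f i 0) (pieceDiam f [i] / 2) ⊆ f i '' S₁ := ball_inscDiam_subset _ _
  have h2 := h.ball_subset_wordMap_image I hpos (h1.trans (h.mapsTo i).image_subset)
  have h3 : ball (wordMap f (i :: I) 0) (maxDeriv f I / D * (pieceDiam f [i] / 2)) ⊆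
      wordMap f (i :: I) '' S₁ := by
    rw [wordMap_cons, Set.image_comp]
    exact h2.trans (Set.image_mono h1)
  have h4 := le_inscDiam (h.wordMap_image_subset (i :: I))
    (mul_nonneg (div_pos hpos h.D_pos).le (div_nonneg (inscDiam_nonneg _ _) zero_le_two)) h3
  calc maxDeriv f I / D * pieceDiam f [i]
      = 2 * (maxDeriv f I / D * (pieceDiam f [i] / 2)) := by ring
    _ ≤ _ := h4

theorem lamK_mul_le (h : IsUnivalentIFS f D) (i : Fin p) :
    D ^ 2 * lamK f D * inscDiam S₁ 0 ≤ pieceDiam f [i] := by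
  have h1 : sInf {x : ℝ | ∃ i : Fin p, x = inscDiam (f i '' S₁) (f i 0) / inscDiam S₁ 0} ≤
      pieceDiam f [i] / inscDiam S₁ 0 := by
    refine csInf_le ⟨0, ?_⟩ ⟨i, rfl⟩
    rintro _ ⟨j, rfl⟩
    exact div_nonneg (inscDiam_nonneg _ _) inscDiam_S₁_pos.le
  rw [le_div_iff₀ inscDiam_S₁_pos] at h1
  have := h.D_pos
  rw [lamK, one_div, mul_inv_cancel_left₀ (by positivity)]
  exact h1

theorem lamK_mul_maxDeriv_le (h : IsUnivalentIFS f D) (i : Fin p) (I : List (Fin p)) :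
    D * lamK f D * maxDeriv f I ≤ maxDeriv f (i :: I) := by
  have hD := h.D_pos
  have h1 := (h.lamK_mul_le i).trans (h.pieceDiam_le [i])
  have h2 := le_of_mul_le_mul_right h1 inscDiam_S₁_pos
  have h3 := h.maxDeriv_mul_le i I
  refine le_of_mul_le_mul_left ?_ hD
  calc D * (D * lamK f D * maxDeriv f I) = maxDeriv f I * (D ^ 2 * lamK f D) := by ring
    _ ≤ maxDeriv f I * maxDeriv f [i] := mul_le_mul_of_nonneg_left h2 (maxDeriv_nonneg _ _)
    _ ≤ _ := h3

theorem maxDeriv_pos (h : IsUnivalentIFS f D) (hl : 0 < lamK f D) (I : List (Fin p)) :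
    0 < maxDeriv f I := by
  induction I with
  | nil => rw [maxDeriv_nil]; exact one_pos
  | cons i I ih =>
    exact (mul_pos (mul_pos h.D_pos hl) ih).trans_le (h.lamK_mul_maxDeriv_le i I)

theorem lamK_mul_pieceDiam_le (h : IsUnivalentIFS f D) (hl : 0 < lamK f D) (i : Fin p)
    (I : List (Fin p)) : D * lamK f D * pieceDiam f I ≤ pieceDiam f (i :: I) := by
  have hD := h.D_pos
  have hM := h.maxDeriv_pos hl I
  calc D * lamK f D * pieceDiam f I ≤ D * lamK f D * (maxDeriv f I * inscDiam S₁ 0) :=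
        mul_le_mul_of_nonneg_left (h.pieceDiam_le I) (mul_pos hD hl).le
    _ = maxDeriv f I / D * (D ^ 2 * lamK f D * inscDiam S₁ 0) := by field_simp
    _ ≤ maxDeriv f I / D * pieceDiam f [i] :=
        mul_le_mul_of_nonneg_left (h.lamK_mul_le i) (div_pos hM hD).le
    _ ≤ _ := h.maxDeriv_mul_pieceDiam_le i I hM

theorem exists_maxDeriv_le_pow (h : IsUnivalentIFS f D) :
    ∃ c : NNReal, c < 1 ∧ ∀ I : List (Fin p), maxDeriv f I ≤ D * c ^ I.length := by
  choose c hc1 hc using h.lipschitz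
  obtain ⟨b, hb1, hb⟩ : ∃ b : NNReal, b < 1 ∧ ∀ i, c i ≤ b :=
    ⟨Finset.univ.sup c, (Finset.sup_lt_iff one_pos).2 fun i _ => hc1 i,
      fun i => Finset.le_sup (Finset.mem_univ i)⟩
  refine ⟨b, hb1, fun I => ?_⟩
  have hlip : LipschitzOnWith (b ^ I.length) (wordMap f I) S₁ := by
    induction I with
    | nil => simpa [wordMap_nil] using LipschitzWith.id.lipschitzOnWith
    | cons i I ih =>
      rw [List.length_cons, pow_succ, wordMap_cons]
      exact ih.comp ((hc i).weaken (hb i)) (h.mapsTo i)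
  have h1 := norm_deriv_le_of_lipschitzOn (isOpen_S₁.mem_nhds zero_mem_S₁) hlip
  refine (h.maxDeriv_le_mul_norm_deriv I zero_mem_closure_S₁).trans ?_
  exact mul_le_mul_of_nonneg_left (by exact_mod_cast h1) h.D_pos.le

theorem norm_wordMap_sub_le (h : IsUnivalentIFS f D) (I : List (Fin p)) {z w : ℂ}
    (hz : z ∈ S₁) (hw : w ∈ S₁) :
    ‖wordMap f I w - wordMap f I z‖ ≤ maxDeriv f I * ‖w - z‖ :=
  convex_S₁.closure.norm_image_sub_le_of_norm_deriv_le (h.wordMap_differentiableAt I)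
    (fun _ hx => h.norm_deriv_le_maxDeriv I hx) (subset_closure hz) (subset_closure hw)

end IsUnivalentIFS

end IteratedFunctionSystem

section Linking

theorem bddAbove_gapDiam (K : Set ℂ) :
    BddAbove {d : ℝ | ∃ c : ℂ, ball c (d/2) ⊆ S₁ ∧ Disjoint (ball c (d/2)) K} :=
  ⟨inscDiam S₁ 0, by
    rintro d ⟨c, hc, -⟩
    simpa [mul_div_cancel₀] using two_mul_radius_le hc⟩

theorem gapDiam_nonneg (K : Set ℂ) : 0 ≤ gapDiam K :=
  le_csSup (bddAbove_gapDiam K) ⟨0, by simp⟩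

theorem exists_mem_ball_of_gapDiam_lt {K : Set ℂ} {c : ℂ} {d : ℝ} (hd : gapDiam K < d)
    (hc : ball c (d / 2) ⊆ S₁) : ∃ y ∈ K, y ∈ ball c (d / 2) := by
  by_contra! h
  exact hd.not_ge (le_csSup (bddAbove_gapDiam K)
    ⟨c, hc, Set.disjoint_right.2 h⟩)

namespace IsUnivalentIFS

variable {p q : ℕ} {f : Fin p → ℂ → ℂ} {g : Fin q → ℂ → ℂ} {D DK DL : ℝ}

/-- Among the pieces around a point of the limit set there is a last one with
derivative at least a given positive size. -/
theorem exists_last_word (h : IsUnivalentIFS f D) {a : ℝ} (ha : 0 < a) {I : List (Fin p)} {y : ℂ}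
    (hy : y ∈ limitSet f) (hI : a ≤ maxDeriv f I) :
    ∃ (I' : List (Fin p)) (i : Fin p), ∃ y' ∈ limitSet f, wordMap f I' y' = wordMap f I y ∧
      a ≤ maxDeriv f I' ∧ maxDeriv f (i :: I') < a := by
  by_contra! hcon
  have key : ∀ n, ∃ I' : List (Fin p), I'.length = I.length + n ∧ ∃ y' ∈ limitSet f,
      wordMap f I' y' = wordMap f I y ∧ a ≤ maxDeriv f I' := by
    intro n
    induction n with
    | zero => exact ⟨I, rfl, y, hy, rfl, hI⟩
    | succ n ih =>
      obtain ⟨I', hlen, y', hy', he, ha'⟩ := ih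
      obtain ⟨i, x, hx, rfl⟩ := h.exists_preimage hy'
      exact ⟨i :: I', by simp [hlen]; omega, x, hx, he, hcon I' i _ hy' he ha'⟩
  obtain ⟨c, hc1, hc⟩ := h.exists_maxDeriv_le_pow
  obtain ⟨n, hn⟩ := exists_pow_lt_of_lt_one (div_pos ha h.D_pos) (show (c : ℝ) < 1 from hc1)
  obtain ⟨I', hlen, -, -, -, ha'⟩ := key n
  rw [lt_div_iff₀' h.D_pos] at hn
  have h1 : (c : ℝ) ^ I'.length ≤ (c : ℝ) ^ n :=
    pow_le_pow_of_le_one c.2 (show (c : ℝ) ≤ 1 from hc1.le) (by omega)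
  have h2 := mul_le_mul_of_nonneg_left h1 h.D_pos.le
  linarith [hc I']

/-- The inscribed disk of the piece `g_J(S₁)` lies in the piece `f_I(S₁)`, and is large
compared to the gaps of the limit set of `f` there. -/
def Linked (f : Fin p → ℂ → ℂ) (g : Fin q → ℂ → ℂ) (I : List (Fin p)) (J : List (Fin q)) : Prop :=
  ball (wordMap g J 0) (pieceDiam g J / 2) ⊆ wordMap f I '' S₁ ∧
    2 * gapDiam (limitSet f) * maxDeriv f I < pieceDiam g J

theorem Linked.exists_son (hK : IsUnivalentIFS f DK) (hL : IsUnivalentIFS g DL)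
    (hson : ∀ (J : List (Fin q)) (c : ℂ) (d : ℝ),
      pieceDiam g J / (20 * DK^2) < d → ball c (d/2) ⊆ wordMap g J '' S₁ →
      ∃ j : Fin q, wordMap g (j :: J) '' S₁ ⊆ ball c (d/2))
    (hlK : 0 < lamK f DK) (hlL : 0 < lamK g DL)
    (hth : gapDiam (limitSet f) ≤ lamK f DK * lamK g DL * inscDiam S₁ 0)
    {I : List (Fin p)} {J : List (Fin q)} (hIJ : Linked f g I J) :
    ∃ (I' : List (Fin p)) (j : Fin q), Linked f g I' (j :: J) := by
  obtain ⟨hsub, hlt⟩ := hIJ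
  have hs := inscDiam_S₁_pos
  have hDK := hK.D_pos
  have hDL := hL.D_pos
  have hgap := gapDiam_nonneg (limitSet f)
  have hMI := hK.maxDeriv_pos hlK I
  have hd : 0 < pieceDiam g J := lt_of_le_of_lt (by positivity) hlt
  set d := pieceDiam g J with hd_def
  obtain ⟨z, hz, hzc⟩ := hsub (mem_ball_self (half_pos hd))
  rw [← hzc] at hsub
  have hdM : d / 4 ≤ maxDeriv f I * inscDiam S₁ 0 := by
    linarith [hK.diam_le_of_ball_subset I hz hsub]
  obtain ⟨y, hy, hyz⟩ := exists_mem_ball_of_gapDiam_lt (K := limitSet f) (c := z)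
    (d := d / (2 * maxDeriv f I)) (by rw [lt_div_iff₀ (by positivity)]; linarith)
    (hK.ball_subset_S₁ I hz hMI le_rfl hsub (by field_simp; norm_num))
  have hyS := limitSet_subset_S₁ f hy
  have hxc : ‖wordMap f I y - wordMap g J 0‖ < d / 4 := by
    rw [← hzc]
    rw [mem_ball_iff_norm, div_div, lt_div_iff₀ (by positivity)] at hyz
    have := hK.norm_wordMap_sub_le I hz hyS
    linarith
  obtain ⟨I', i, y', hy', hyy, hM1, hM2⟩ := hK.exists_last_word
    (a := d / 4 / inscDiam S₁ 0) (by positivity) hy (by rwa [div_le_iff₀ hs])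
  have hMI' := hK.maxDeriv_pos hlK I'
  have hy'S := limitSet_subset_S₁ f hy'
  rw [div_le_iff₀ hs] at hM1
  rw [lt_div_iff₀ hs] at hM2
  obtain ⟨b, hbS, hb1, hb2⟩ := exists_ball_subset_S₁ hy'S (t := d / 4 / maxDeriv f I')
    (by positivity) (by rwa [div_le_iff₀' hMI'])
  have himg := hK.ball_subset_wordMap_image I' hMI' hb1
  have hrad : maxDeriv f I' / DK * (d / 4 / maxDeriv f I' / 3) = d / (6 * DK) / 2 := by
    field_simp; norm_num
  rw [hrad] at himg
  have hgJ : ball (wordMap f I' b) (d / (6 * DK) / 2) ⊆ wordMap g J '' S₁ := by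
    refine Set.Subset.trans ?_ (ball_inscDiam_subset _ (wordMap g J 0))
    intro w hw
    obtain ⟨v, hv, rfl⟩ := himg hw
    have h1 := hb2 hv
    rw [mem_ball_iff_norm, lt_div_iff₀' hMI'] at h1
    have h2 := hK.norm_wordMap_sub_le I' hy'S (hb1 hv)
    rw [hyy] at h2
    rw [mem_ball_iff_norm]
    have h3 : ‖wordMap f I' v - wordMap g J 0‖ ≤
        ‖wordMap f I' v - wordMap f I y‖ + ‖wordMap f I y - wordMap g J 0‖ :=
      norm_sub_le_norm_sub_add_norm_sub _ _ _
    change _ < d / 2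
    linarith
  obtain ⟨j, hj⟩ := hson J (wordMap f I' b) (d / (6 * DK)) (by
    have := hK.one_le
    rw [← hd_def, div_lt_div_iff_of_pos_left hd (by positivity) (by positivity)]
    nlinarith) hgJ
  refine ⟨I', j, ?_, ?_⟩
  · exact (ball_inscDiam_subset _ _).trans
      (hj.trans (himg.trans (Set.image_mono hb1)))
  · have h1 := hL.lamK_mul_pieceDiam_le hlL j J
    have h2 := mul_le_mul_of_nonneg_right (hK.lamK_mul_maxDeriv_le i I') hs.le
    have hDD : 1 ≤ DK * DL := one_le_mul_of_one_le_of_one_le hK.one_le hL.one_le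
    have h3 : 4 * (DK * lamK f DK * maxDeriv f I' * inscDiam S₁ 0) < d := by linarith
    rw [← hd_def] at h1
    have hP : 0 < lamK f DK * lamK g DL * inscDiam S₁ 0 * maxDeriv f I' := by positivity
    calc 2 * gapDiam (limitSet f) * maxDeriv f I'
        ≤ 2 * (lamK f DK * lamK g DL * inscDiam S₁ 0) * maxDeriv f I' := by gcongr
      _ ≤ (DK * DL) * (4 * (lamK f DK * lamK g DL * inscDiam S₁ 0 * maxDeriv f I')) := by
          nlinarith
      _ = DL * lamK g DL * (4 * (DK * lamK f DK * maxDeriv f I' * inscDiam S₁ 0)) := by ring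
      _ < DL * lamK g DL * d := by gcongr
      _ ≤ _ := h1

theorem lamK_le_one (h : IsUnivalentIFS f D) : lamK f D ≤ 1 := by
  have h0 := inscDiam_S₁_pos
  have h1 : D ^ 2 * lamK f D * inscDiam S₁ 0 ≤ inscDiam S₁ 0 := by
    have h2 := two_mul_radius_le
      ((ball_inscDiam_subset _ (wordMap f [⟨0, h.pos⟩] 0)).trans
        (h.wordMap_image_subset [⟨0, h.pos⟩]))
    have h3 := h.lamK_mul_le ⟨0, h.pos⟩
    rw [pieceDiam] at h3
    linarith
  have h2 := one_le_pow₀ h.one_le (n := 2)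
  have h3 : D ^ 2 * lamK f D ≤ 1 := by nlinarith
  nlinarith [lamK_nonneg f D]

theorem lamK_lt_half (h : IsUnivalentIFS g DL) (hDK : 1 ≤ DK)
    (hson : ∀ (J : List (Fin q)) (c : ℂ) (d : ℝ),
      pieceDiam g J / (20 * DK^2) < d → ball c (d/2) ⊆ wordMap g J '' S₁ →
      ∃ j : Fin q, wordMap g (j :: J) '' S₁ ⊆ ball c (d/2)) : lamK g DL < 1 / 2 := by
  have h0 := inscDiam_S₁_pos
  have hball : ball (0 : ℂ) (inscDiam S₁ 0 / 10 / 2) ⊆ wordMap g [] '' S₁ := by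
    rw [wordMap_nil, Set.image_id]
    exact (ball_subset_ball (by linarith)).trans (ball_inscDiam_subset S₁ 0)
  obtain ⟨j, hj⟩ := hson [] 0 (inscDiam S₁ 0 / 10) (by
    have := one_le_pow₀ hDK (n := 2)
    rw [pieceDiam_nil]
    exact div_lt_div_of_pos_left h0 (by norm_num) (by linarith)) hball
  have h1 := radius_le_of_ball_subset_strip (b := inscDiam S₁ 0 / 10 / 2) (by positivity)
    (((ball_inscDiam_subset _ (wordMap g [j] 0)).trans hj).trans fun z hz =>
      (Complex.abs_re_le_norm z).trans_lt (mem_ball_zero_iff.1 hz))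
  have h2 := h.lamK_mul_le j
  rw [pieceDiam] at h2
  have h3 := one_le_pow₀ h.one_le (n := 2)
  have h4 : DL ^ 2 * lamK g DL ≤ 1 / 10 := by nlinarith
  nlinarith [lamK_nonneg g DL]

theorem inter_nonempty_of_gapDiam_le (hK : IsUnivalentIFS f DK) (hL : IsUnivalentIFS g DL)
    (hson : ∀ (J : List (Fin q)) (c : ℂ) (d : ℝ),
      pieceDiam g J / (20 * DK^2) < d → ball c (d/2) ⊆ wordMap g J '' S₁ →
      ∃ j : Fin q, wordMap g (j :: J) '' S₁ ⊆ ball c (d/2))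
    (hlK : 0 < lamK f DK) (hlL : 0 < lamK g DL) (hgap : 0 < gapDiam (limitSet f))
    (hth : gapDiam (limitSet f) ≤ lamK f DK * lamK g DL * inscDiam S₁ 0) :
    (limitSet f ∩ limitSet g).Nonempty := by
  have hs := inscDiam_S₁_pos
  have key : ∀ n, ∃ (I : List (Fin p)) (J : List (Fin q)), J.length = n ∧ Linked f g I J := by
    intro n
    induction n with
    | zero =>
      refine ⟨[], [], rfl, ?_, ?_⟩
      · rw [pieceDiam_nil]
        simpa [wordMap_nil] using ball_inscDiam_subset S₁ 0
      · rw [pieceDiam_nil, maxDeriv_nil]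
        have h1 := hK.lamK_le_one
        have h2 := hL.lamK_lt_half hK.one_le hson
        have h3 : lamK f DK * lamK g DL < 1 / 2 := by nlinarith
        nlinarith
    | succ n ih =>
      obtain ⟨I, J, hJ, hIJ⟩ := ih
      obtain ⟨I', j, h⟩ := Linked.exists_son hK hL hson hlK hlL hth hIJ
      exact ⟨I', j :: J, by simp [hJ], h⟩
  by_contra hemp
  rw [Set.not_nonempty_iff_eq_empty, ← Set.disjoint_iff_inter_eq_empty] at hemp
  obtain ⟨ε, hε, hdisj⟩ := hemp.exists_thickenings hK.isCompact_limitSet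
    hL.isCompact_limitSet.isClosed
  obtain ⟨k, hk⟩ := hK.nonempty_limitSet
  obtain ⟨l, hl⟩ := hL.nonempty_limitSet
  obtain ⟨c, hc1, hc⟩ := hL.exists_maxDeriv_le_pow
  have hlim : Filter.Tendsto (fun n : ℕ => DL * (c : ℝ) ^ n) Filter.atTop (nhds 0) := by
    simpa using (tendsto_pow_atTop_nhds_zero_of_lt_one c.2 (show (c : ℝ) < 1 from hc1)).const_mul DL
  obtain ⟨n, hn1, hn2⟩ := ((hlim.eventually_lt_const (u := ε / (2 * inscDiam S₁ 0))
    (by positivity)).and (hlim.eventually_lt_const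
    (u := gapDiam (limitSet f) * ε / inscDiam S₁ 0 ^ 2) (by positivity))).exists
  obtain ⟨I, J, rfl, hsub, hlt⟩ := key n
  have hd0 := (hL.maxDeriv_pos hlL J)
  have hd : 0 < pieceDiam g J := lt_of_le_of_lt
    (mul_nonneg (by positivity) (maxDeriv_nonneg f I)) hlt
  obtain ⟨z, hz, hzc⟩ := hsub (mem_ball_self (half_pos hd))
  have hMJ := hc J
  have hdJ := hL.pieceDiam_le J
  have hnorm : ∀ {u v : ℂ}, u ∈ S₁ → v ∈ S₁ → ‖u - v‖ ≤ 2 * inscDiam S₁ 0 := fun {u v} hu hv => by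
    linarith [norm_sub_le u v, norm_lt_of_mem_S₁ hu, norm_lt_of_mem_S₁ hv]
  have h1 := hL.norm_wordMap_sub_le J zero_mem_S₁ (limitSet_subset_S₁ g hl)
  have h2 := hK.norm_wordMap_sub_le I hz (limitSet_subset_S₁ f hk)
  rw [hzc] at h2
  have h3 : maxDeriv g J * ‖l - 0‖ < ε := by
    rw [lt_div_iff₀ (by positivity)] at hn1
    have := mul_le_mul_of_nonneg_left (hnorm (limitSet_subset_S₁ g hl) zero_mem_S₁) hd0.le
    nlinarith
  have h4 : maxDeriv f I * ‖k - z‖ < ε := by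
    rw [lt_div_iff₀ (by positivity)] at hn2
    have e1 := mul_le_mul_of_nonneg_left (hnorm (limitSet_subset_S₁ f hk) hz)
      (maxDeriv_nonneg f I)
    have e2 : maxDeriv g J * inscDiam S₁ 0 ^ 2 < gapDiam (limitSet f) * ε :=
      (mul_le_mul_of_nonneg_right hMJ (by positivity)).trans_lt hn2
    have e3 := mul_lt_mul_of_pos_right (hlt.trans_le hdJ) hs
    refine e1.trans_lt (lt_of_mul_lt_mul_left ?_ hgap.le)
    linarith
  refine hdisj.notMem_of_mem_left (a := wordMap g J 0)
    (mem_thickening_iff.2 ⟨_, hK.wordMap_mapsTo_limitSet I hk, ?_⟩)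
    (mem_thickening_iff.2 ⟨_, hL.wordMap_mapsTo_limitSet J hl, ?_⟩)
  · rw [dist_eq_norm']; linarith
  · rw [dist_eq_norm']; linarith

theorem inter_nonempty_of_sigmaK_le (hK : IsUnivalentIFS f DK) (hL : IsUnivalentIFS g DL)
    (hson : ∀ (J : List (Fin q)) (c : ℂ) (d : ℝ),
      pieceDiam g J / (20 * DK^2) < d → ball c (d/2) ⊆ wordMap g J '' S₁ →
      ∃ j : Fin q, wordMap g (j :: J) '' S₁ ⊆ ball c (d/2))
    (hthick : 1 ≤ thickK f DK * thickK g DL) (hσ : sigmaK f DK ≤ sigmaK g DL) :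
    (limitSet f ∩ limitSet g).Nonempty := by
  have hs := inscDiam_S₁_pos
  have hDK := hK.D_pos
  have hDL := hL.D_pos
  have hne : thickK f DK * thickK g DL ≠ 0 := (one_pos.trans_le hthick).ne'
  have hne1 := left_ne_zero_of_mul hne
  have hne2 := right_ne_zero_of_mul hne
  rw [thickK, div_ne_zero_iff] at hne1 hne2
  have hlK := (lamK_nonneg f DK).lt_of_ne' hne1.1
  have hlL := (lamK_nonneg g DL).lt_of_ne' hne2.1
  have hσK : 0 < √(sigmaK f DK) :=
    (Real.sqrt_nonneg _).lt_of_ne' (right_ne_zero_of_mul hne1.2)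
  have hσL : 0 < √(sigmaK g DL) :=
    (Real.sqrt_nonneg _).lt_of_ne' (right_ne_zero_of_mul hne2.2)
  have hσ0 : 0 < sigmaK f DK := Real.sqrt_pos.1 hσK
  have hgap : 0 < gapDiam (limitSet f) := by
    refine (gapDiam_nonneg _).lt_of_ne' fun h0 => ?_
    rw [sigmaK, h0] at hσ0
    simp at hσ0
  refine inter_nonempty_of_gapDiam_le hK hL hson hlK hlL hgap ?_
  rw [thickK, thickK, div_mul_div_comm, one_le_div (by positivity)] at hthick
  have h1 : sigmaK f DK ≤ √(sigmaK f DK) * √(sigmaK g DL) := by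
    conv_lhs => rw [← Real.mul_self_sqrt hσ0.le]
    gcongr
  have h2 : 1 ≤ DK ^ 2 := one_le_pow₀ hK.one_le
  have h3 : 1 ≤ DL ^ 2 := one_le_pow₀ hL.one_le
  have h4 : gapDiam (limitSet f) / inscDiam S₁ 0 ≤ sigmaK f DK :=
    le_mul_of_one_le_left (by positivity) h2
  rw [← div_le_iff₀ hs]
  calc gapDiam (limitSet f) / inscDiam S₁ 0 ≤ √(sigmaK f DK) * √(sigmaK g DL) := h4.trans h1
    _ ≤ (DK ^ 2 * DL ^ 2) * (√(sigmaK f DK) * √(sigmaK g DL)) :=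
        le_mul_of_one_le_left (by positivity) (one_le_mul_of_one_le_of_one_le h2 h3)
    _ = DK ^ 2 * √(sigmaK f DK) * (DL ^ 2 * √(sigmaK g DL)) := by ring
    _ ≤ _ := hthick

end IsUnivalentIFS

end Linking

/-- **The Complex Gap Lemma.** Let `K`, `L` be limit sets of IFSs of univalent
contractions on the square `S₁`, with distortions bounded by `D_K`, `D_L`. If `K`, `L`
are well balanced (`max(Λ_K, Λ_L) < 1/20` and every disk of diameter `> δ(P)/(20·D_L²)`
(resp. `> δ(P)/(20·D_K²)`) in a piece `P` of `K` (resp. of `L`) contains a son of `P`)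
and `t(K)·t(L) ≥ 1`, then `K ∩ L ≠ ∅`. -/
theorem complex_gap_lemma (p q : ℕ) (hp : 0 < p) (hq : 0 < q)
    (U : Set ℂ) (hU : IsOpen U) (hSU : closure S₁ ⊆ U)
    (f : Fin p → ℂ → ℂ) (g : Fin q → ℂ → ℂ)
    (hf : ∀ i, DifferentiableOn ℂ (f i) U ∧ Set.InjOn (f i) U)
    (hg : ∀ j, DifferentiableOn ℂ (g j) U ∧ Set.InjOn (g j) U)
    (hinf : ∀ i, closure (f i '' S₁) ⊆ S₁)
    (hing : ∀ j, closure (g j '' S₁) ⊆ S₁)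
    (hcontrf : ∀ i, ∃ c : NNReal, c < 1 ∧ LipschitzOnWith c (f i) S₁)
    (hcontrg : ∀ j, ∃ c : NNReal, c < 1 ∧ LipschitzOnWith c (g j) S₁)
    (DK DL : ℝ) (hDK : 1 ≤ DK) (hDL : 1 ≤ DL)
    (hdistf : ∀ (I : List (Fin p)), ∀ z ∈ closure S₁, ∀ z' ∈ closure S₁,
      ‖deriv (wordMap f I) z‖ ≤ DK * ‖deriv (wordMap f I) z'‖)
    (hdistg : ∀ (J : List (Fin q)), ∀ z ∈ closure S₁, ∀ z' ∈ closure S₁,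
      ‖deriv (wordMap g J) z‖ ≤ DL * ‖deriv (wordMap g J) z'‖)
    (hLamf : LamK f DK < 1/20) (hLamg : LamK g DL < 1/20)
    (hsonf : ∀ (I : List (Fin p)) (c : ℂ) (d : ℝ),
      inscDiam (wordMap f I '' S₁) (wordMap f I 0) / (20 * DL^2) < d →
      ball c (d/2) ⊆ wordMap f I '' S₁ →
      ∃ i : Fin p, wordMap f (i :: I) '' S₁ ⊆ ball c (d/2))
    (hsong : ∀ (J : List (Fin q)) (c : ℂ) (d : ℝ),
      inscDiam (wordMap g J '' S₁) (wordMap g J 0) / (20 * DK^2) < d →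
      ball c (d/2) ⊆ wordMap g J '' S₁ →
      ∃ j : Fin q, wordMap g (j :: J) '' S₁ ⊆ ball c (d/2))
    (hthick : 1 ≤ thickK f DK * thickK g DL) :
    (limitSet f ∩ limitSet g).Nonempty := by
  have hK : IsUnivalentIFS f DK :=
    ⟨hp, fun i z hz => (hf i).1.differentiableAt (hU.mem_nhds (hSU hz)),
      fun i => (hf i).2.mono hSU, hinf, hcontrf, hDK, hdistf⟩
  have hL : IsUnivalentIFS g DL :=
    ⟨hq, fun i z hz => (hg i).1.differentiableAt (hU.mem_nhds (hSU hz)),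
      fun i => (hg i).2.mono hSU, hing, hcontrg, hDL, hdistg⟩
  rcases le_total (sigmaK f DK) (sigmaK g DL) with h | h
  · exact hK.inter_nonempty_of_sigmaK_le hL hsong hthick h
  · rw [Set.inter_comm]
    rw [mul_comm] at hthick
    exact hL.inter_nonempty_of_sigmaK_le hK hsonf hthick h
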